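/- arXiv:2402.08223 — 6 statements merged into one kernel-verified Lean document; each statement's English description precedes it below -/
import Mathlib

section
/- Assume β ≤ min{2η, 2(1−η)}. Then the set S of pairs (Σ_{α ∈ supp σ} σ(α)·U_c^δ(α), Σ_{α ∈ supp σ} σ(α)·U_p^δ(α)), where σ ranges over finitely supported functions from [0,1] to [0,1] with Σ_α σ(α) = 1 and Σ_α σ(α)·α = α*, and δ ranges over [0,1], is equal to the merged utility set M. -/
noncomputable def f1 (v1 v2 β tstar α : ℝ) : ℝ :=
  (1 - β + β * tstar) * v1 + β * (1 - tstar) * α * v2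

noncomputable def g1 (v1 v2 β tstar α : ℝ) : ℝ :=
  (1 - β + β * tstar) * α * (v2 - v1)

noncomputable def f2 (v1 v2 β tstar α : ℝ) : ℝ :=
  β * tstar * v1 + (1 - β + β * (1 - tstar)) * α * v2

noncomputable def g2 (v1 v2 β tstar α : ℝ) : ℝ :=
  β * tstar * α * (v2 - v1)

/-- Expected producer utility `U_p^δ(α)` from a market with high-value fraction `α`. -/
noncomputable def Up (v1 v2 β tstar δ α : ℝ) : ℝ :=
  if α < tstar then f1 v1 v2 β tstar α
  else if tstar < α then f2 v1 v2 β tstar α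
  else (1 - δ) * f1 v1 v2 β tstar tstar + δ * f2 v1 v2 β tstar tstar

/-- Expected consumer utility `U_c^δ(α)` from a market with high-value fraction `α`. -/
noncomputable def Uc (v1 v2 β tstar δ α : ℝ) : ℝ :=
  if α < tstar then g1 v1 v2 β tstar α
  else if tstar < α then g2 v1 v2 β tstar α
  else (1 - δ) * g1 v1 v2 β tstar tstar + δ * g2 v1 v2 β tstar tstar

/-- The merged utility set `M`. -/
def mergedSet (v1 v2 β tstar αstar : ℝ) : Set (ℝ × ℝ) :=
  {p | ∃ α1 α2 γ1 γ2 : ℝ,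
    α1 ∈ Set.Icc (0 : ℝ) (min tstar αstar) ∧
    α2 ∈ Set.Icc (max tstar αstar) (1 : ℝ) ∧
    γ1 ∈ Set.Icc (0 : ℝ) 1 ∧ γ2 ∈ Set.Icc (0 : ℝ) 1 ∧
    γ1 + γ2 = 1 ∧ γ1 * α1 + γ2 * α2 = αstar ∧
    p = (γ1 * g1 v1 v2 β tstar α1 + γ2 * g2 v1 v2 β tstar α2,
         γ1 * f1 v1 v2 β tstar α1 + γ2 * f2 v1 v2 β tstar α2)}

/-- The fraction of the mass at `a` that is treated as lying below the threshold `t`, when ties are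
broken upwards with probability `δ`. -/
noncomputable def lowShare (t δ a : ℝ) : ℝ :=
  if a < t then 1 else if t < a then 0 else 1 - δ

lemma lowShare_nonneg {δ : ℝ} (hδ : δ ≤ 1) (t a : ℝ) : 0 ≤ lowShare t δ a := by
  unfold lowShare; split_ifs <;> linarith

lemma lowShare_le_one {δ : ℝ} (hδ : 0 ≤ δ) (t a : ℝ) : lowShare t δ a ≤ 1 := by
  unfold lowShare; split_ifs <;> linarith

lemma lowShare_mul_le {δ : ℝ} (t a : ℝ) :
    lowShare t δ a * a ≤ lowShare t δ a * t := by
  unfold lowShare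
  split_ifs with h₁ h₂
  · linarith
  · linarith
  · rw [le_antisymm (not_lt.1 h₂) (not_lt.1 h₁)]

lemma one_sub_lowShare_mul_le {δ : ℝ} (t a : ℝ) :
    (1 - lowShare t δ a) * t ≤ (1 - lowShare t δ a) * a := by
  unfold lowShare
  split_ifs with h₁ h₂
  · linarith
  · linarith
  · rw [le_antisymm (not_lt.1 h₂) (not_lt.1 h₁)]

lemma Uc_eq_lowShare (v1 v2 β t δ a : ℝ) :
    Uc v1 v2 β t δ a =
      lowShare t δ a * g1 v1 v2 β t a + (1 - lowShare t δ a) * g2 v1 v2 β t a := by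
  unfold Uc lowShare
  split_ifs with h₁ h₂
  · ring
  · ring
  · rw [le_antisymm (not_lt.1 h₂) (not_lt.1 h₁)]; ring

lemma Up_eq_lowShare (v1 v2 β t δ a : ℝ) :
    Up v1 v2 β t δ a =
      lowShare t δ a * f1 v1 v2 β t a + (1 - lowShare t δ a) * f2 v1 v2 β t a := by
  unfold Up lowShare
  split_ifs with h₁ h₂
  · ring
  · ring
  · rw [le_antisymm (not_lt.1 h₂) (not_lt.1 h₁)]; ring

lemma threshold_mem_Icc {β η : ℝ} (hβ1 : β < 1) (hβ : β ≤ min (2 * η) (2 * (1 - η))) :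
    (η - β / 2) / (1 - β) ∈ Set.Icc (0 : ℝ) 1 := by
  obtain ⟨h₁, h₂⟩ := le_min_iff.1 hβ
  have : 0 < 1 - β := by linarith
  exact ⟨div_nonneg (by linarith) this.le, (div_le_one this).2 (by linarith)⟩

/-- Masses `γ1`, `γ2` with first moments `m1`, `m2` on either side of the threshold are realised by
two points. -/
lemma mem_mergedSet_of_moments {v1 v2 β t s γ1 γ2 m1 m2 : ℝ}
    (ht : t ∈ Set.Icc (0 : ℝ) 1) (hs : s ∈ Set.Icc (0 : ℝ) 1)
    (hγ1 : 0 ≤ γ1) (hγ2 : 0 ≤ γ2) (hγ : γ1 + γ2 = 1) (hm : m1 + m2 = s)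
    (hm1 : 0 ≤ m1) (hm1t : m1 ≤ γ1 * t) (hm2t : γ2 * t ≤ m2) (hm2 : m2 ≤ γ2) :
    ((1 - β + β * t) * (v2 - v1) * m1 + β * t * (v2 - v1) * m2,
      (1 - β + β * t) * v1 * γ1 + β * (1 - t) * v2 * m1 +
        (β * t * v1 * γ2 + (1 - β + β * (1 - t)) * v2 * m2)) ∈ mergedSet v1 v2 β t s := by
  have key : γ2 * m1 ≤ γ1 * m2 := by
    nlinarith [mul_le_mul_of_nonneg_left hm1t hγ2, mul_le_mul_of_nonneg_left hm2t hγ1]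
  obtain rfl : γ2 = 1 - γ1 := by linarith
  obtain ⟨a1, ha1, e1⟩ : ∃ a1 ∈ Set.Icc (0 : ℝ) (min t s), γ1 * a1 = m1 := by
    rcases hγ1.eq_or_lt with h | h
    · subst h
      exact ⟨0, ⟨le_rfl, le_min ht.1 hs.1⟩, by linarith⟩
    · refine ⟨m1 / γ1, ⟨by positivity, le_min ?_ ?_⟩, by field_simp⟩
      · rw [div_le_iff₀ h]; linarith
      · rw [div_le_iff₀ h]; nlinarith
  obtain ⟨a2, ha2, e2⟩ : ∃ a2 ∈ Set.Icc (max t s) (1 : ℝ), (1 - γ1) * a2 = m2 := by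
    rcases hγ2.eq_or_lt with h | h
    · refine ⟨1, ⟨max_le ht.2 hs.2, le_rfl⟩, ?_⟩
      rw [← h] at hm2 hm2t ⊢
      linarith
    · refine ⟨m2 / (1 - γ1), ⟨max_le ?_ ?_, ?_⟩, by field_simp⟩
      · rw [le_div_iff₀ h]; linarith
      · rw [le_div_iff₀ h]; nlinarith
      · rw [div_le_one h]; exact hm2
  refine ⟨a1, a2, γ1, 1 - γ1, ha1, ha2, ⟨hγ1, by linarith⟩, ⟨hγ2, by linarith⟩, hγ,
    by rw [e1, e2, hm], ?_⟩
  subst e1 e2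
  unfold g1 g2 f1 f2
  ext <;> ring

lemma segmentation_mem_mergedSet {v1 v2 β t s δ : ℝ} {σ : ℝ →₀ ℝ}
    (ht : t ∈ Set.Icc (0 : ℝ) 1) (hs : s ∈ Set.Icc (0 : ℝ) 1) (hδ : δ ∈ Set.Icc (0 : ℝ) 1)
    (hsupp : ∀ a ∈ σ.support, a ∈ Set.Icc (0 : ℝ) 1) (hσ : ∀ a, 0 ≤ σ a)
    (hsum : σ.sum (fun _ w => w) = 1) (hmean : σ.sum (fun a w => w * a) = s) :
    (σ.sum (fun a w => w * Uc v1 v2 β t δ a), σ.sum (fun a w => w * Up v1 v2 β t δ a)) ∈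
      mergedSet v1 v2 β t s := by
  have hl0 := lowShare_nonneg hδ.2 t
  have hl1 : ∀ a, 0 ≤ 1 - lowShare t δ a := fun a => sub_nonneg.2 (lowShare_le_one hδ.1 t a)
  unfold Finsupp.sum at *
  convert mem_mergedSet_of_moments (v1 := v1) (v2 := v2) (β := β) ht hs
    (γ1 := ∑ a ∈ σ.support, σ a * lowShare t δ a)
    (γ2 := ∑ a ∈ σ.support, σ a * (1 - lowShare t δ a))
    (m1 := ∑ a ∈ σ.support, σ a * (lowShare t δ a * a))
    (m2 := ∑ a ∈ σ.support, σ a * ((1 - lowShare t δ a) * a)) ?_ ?_ ?_ ?_ ?_ ?_ ?_ ?_ using 2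
  · simp only [Finset.mul_sum, ← Finset.sum_add_distrib]
    refine Finset.sum_congr rfl fun a _ => ?_
    rw [Uc_eq_lowShare, g1, g2]
    ring
  · simp only [Finset.mul_sum, ← Finset.sum_add_distrib]
    refine Finset.sum_congr rfl fun a _ => ?_
    rw [Up_eq_lowShare, f1, f2]
    ring
  · exact Finset.sum_nonneg fun a _ => mul_nonneg (hσ a) (hl0 a)
  · exact Finset.sum_nonneg fun a _ => mul_nonneg (hσ a) (hl1 a)
  · rw [← Finset.sum_add_distrib]
    exact (Finset.sum_congr rfl fun a _ => by ring).trans hsum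
  · rw [← Finset.sum_add_distrib]
    exact (Finset.sum_congr rfl fun a _ => by ring).trans hmean
  · exact Finset.sum_nonneg fun a ha => mul_nonneg (hσ a) (mul_nonneg (hl0 a) (hsupp a ha).1)
  · rw [Finset.sum_mul]
    refine Finset.sum_le_sum fun a _ => ?_
    rw [mul_assoc]
    exact mul_le_mul_of_nonneg_left (lowShare_mul_le t a) (hσ a)
  · rw [Finset.sum_mul]
    refine Finset.sum_le_sum fun a _ => ?_
    rw [mul_assoc]
    exact mul_le_mul_of_nonneg_left (one_sub_lowShare_mul_le t a) (hσ a)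
  · exact Finset.sum_le_sum fun a ha => mul_le_mul_of_nonneg_left
      (mul_le_of_le_one_right (hl1 a) (hsupp a ha).2) (hσ a)

lemma sum_single_add_single_mul (a1 a2 γ1 γ2 : ℝ) (u : ℝ → ℝ) :
    (Finsupp.single a1 γ1 + Finsupp.single a2 γ2).sum (fun a w => w * u a) =
      γ1 * u a1 + γ2 * u a2 := by
  rw [Finsupp.sum_add_index' (by simp) (by intros; ring)]
  simp

/-- Tie-breaking can be chosen so that `a1 ≤ t` is served as a low market and `a2 ≥ t` as a high
one, at least in the `γ1`, `γ2`-average. -/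
lemma exists_lowShare_average {t a1 a2 γ1 γ2 : ℝ} (h1 : a1 ≤ t) (h2 : t ≤ a2)
    (hγ2 : γ2 ∈ Set.Icc (0 : ℝ) 1) (hγ : γ1 + γ2 = 1) :
    ∃ δ ∈ Set.Icc (0 : ℝ) 1, ∀ l h : ℝ → ℝ,
      γ1 * (lowShare t δ a1 * l a1 + (1 - lowShare t δ a1) * h a1) +
        γ2 * (lowShare t δ a2 * l a2 + (1 - lowShare t δ a2) * h a2) =
      γ1 * l a1 + γ2 * h a2 := by
  unfold lowShare
  rcases h1.lt_or_eq with h1 | rfl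
  · exact ⟨1, by simp, fun l h => by simp [h1, h2.not_gt]⟩
  rcases h2.lt_or_eq with h2 | rfl
  · exact ⟨0, by simp, fun l h => by simp [h2, h2.not_gt]⟩
  · refine ⟨γ2, hγ2, fun l h => ?_⟩
    obtain rfl : γ1 = 1 - γ2 := by linarith
    simp only [lt_irrefl, if_false]
    ring

/-- the set `S` of aggregate consumer/producer expected-utility pairs,
achievable by finitely supported segmentations of the aggregate market `α*` together
with an optimal tie-breaking parameter `δ ∈ [0,1]`, equals the merged utility set `M`. -/
theorem stmt_2 (v1 v2 β η tstar αstar : ℝ)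
    (hv1 : 0 < v1) (hv12 : v1 < v2)
    (hβ0 : 0 ≤ β) (hβ1 : β < 1)
    (hη : η = v1 / v2) (ht : tstar = (η - β / 2) / (1 - β))
    (hβ : β ≤ min (2 * η) (2 * (1 - η)))
    (hαstar : αstar ∈ Set.Icc (0 : ℝ) 1) :
    {p : ℝ × ℝ | ∃ (σ : ℝ →₀ ℝ) (δ : ℝ), δ ∈ Set.Icc (0 : ℝ) 1 ∧
      (∀ a ∈ σ.support, a ∈ Set.Icc (0 : ℝ) 1) ∧
      (∀ a, σ a ∈ Set.Icc (0 : ℝ) 1) ∧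
      σ.sum (fun _ w => w) = 1 ∧
      σ.sum (fun a w => w * a) = αstar ∧
      p = (σ.sum (fun a w => w * Uc v1 v2 β tstar δ a),
           σ.sum (fun a w => w * Up v1 v2 β tstar δ a))}
    = mergedSet v1 v2 β tstar αstar := by
  have htI : tstar ∈ Set.Icc (0 : ℝ) 1 := ht ▸ threshold_mem_Icc hβ1 hβ
  apply Set.Subset.antisymm
  · rintro _ ⟨σ, δ, hδ, hsupp, hσ, hsum, hmean, rfl⟩
    exact segmentation_mem_mergedSet htI hαstar hδ hsupp (fun a => (hσ a).1) hsum hmean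
  · rintro _ ⟨a1, a2, γ1, γ2, ha1, ha2, hγ1, hγ2, hγ, hmean, rfl⟩
    have h1 := ha1.2.trans (min_le_left _ _)
    have h2 := (le_max_left _ _).trans ha2.1
    obtain ⟨δ, hδ, hu⟩ := exists_lowShare_average h1 h2 hγ2 hγ
    refine ⟨Finsupp.single a1 γ1 + Finsupp.single a2 γ2, δ, hδ, ?_, ?_, ?_, ?_, ?_⟩
    · intro a ha
      rcases Finset.mem_union.1 (Finsupp.support_add ha) with h | h
      · rw [Finset.mem_singleton.1 (Finsupp.support_single_subset h)]
        exact ⟨ha1.1, h1.trans htI.2⟩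
      · rw [Finset.mem_singleton.1 (Finsupp.support_single_subset h)]
        exact ⟨htI.1.trans h2, ha2.2⟩
    · intro a
      have := hγ1.1
      have := hγ2.1
      simp only [Finsupp.add_apply, Finsupp.single_apply]
      constructor <;> split_ifs <;> linarith
    · simpa [hγ] using sum_single_add_single_mul a1 a2 γ1 γ2 (fun _ => 1)
    · exact (sum_single_add_single_mul a1 a2 γ1 γ2 id).trans hmean
    · rw [sum_single_add_single_mul, sum_single_add_single_mul]
      simp only [Uc_eq_lowShare, Up_eq_lowShare, hu]
end

section
/- Assume β ≤ min{2η, 2(1−η)}. Then M = { β·c + (1−β)·s' : s' ∈ S' }, i.e., the set of achievable consumer–producer utility pairs under the privacy mechanism equals a constant shift by β·c of the (1−β)-scaled set S'. -/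
/-- The set `S'`. -/
def Sprime (v1 v2 tstar αstar : ℝ) : Set (ℝ × ℝ) :=
  {p | ∃ α1 α2 γ1 γ2 : ℝ,
    α1 ∈ Set.Icc (0 : ℝ) (min tstar αstar) ∧
    α2 ∈ Set.Icc (max tstar αstar) (1 : ℝ) ∧
    γ1 ∈ Set.Icc (0 : ℝ) 1 ∧ γ2 ∈ Set.Icc (0 : ℝ) 1 ∧
    γ1 + γ2 = 1 ∧ γ1 * α1 + γ2 * α2 = αstar ∧
    p = (γ1 * α1 * (v2 - v1), γ1 * v1 + γ2 * α2 * v2)}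

/-- Splitting a market into two segments with aggregate `αstar` yields the same utilities as the
constant shift of the scaled utilities without privacy. -/
theorem merged_eq_shift_add_smul {v1 v2 β tstar αstar α1 α2 γ1 γ2 : ℝ}
    (hγ : γ1 + γ2 = 1) (hα : γ1 * α1 + γ2 * α2 = αstar) :
    (γ1 * g1 v1 v2 β tstar α1 + γ2 * g2 v1 v2 β tstar α2,
      γ1 * f1 v1 v2 β tstar α1 + γ2 * f2 v1 v2 β tstar α2)
      = β • ((tstar * αstar * (v2 - v1),
          tstar * v1 + (1 - tstar) * αstar * v2) : ℝ × ℝ)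
        + (1 - β) • ((γ1 * α1 * (v2 - v1), γ1 * v1 + γ2 * α2 * v2) : ℝ × ℝ) := by
  simp only [f1, f2, g1, g2, Prod.smul_mk, Prod.mk_add_mk, smul_eq_mul, Prod.mk.injEq]
  constructor
  · linear_combination β * tstar * (v2 - v1) * hα
  · linear_combination β * tstar * v1 * hγ + β * (1 - tstar) * v2 * hα

/-- the merged utility set `M` equals the constant shift by `β·c` of
the `(1−β)`-scaled set `S'`, where
`c = (t*·α*·(v2−v1), t*·v1 + (1−t*)·α*·v2)`. -/
theorem stmt_3 (v1 v2 β η tstar αstar : ℝ)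
    (hv1 : 0 < v1) (hv12 : v1 < v2)
    (hβ0 : 0 ≤ β) (hβ1 : β < 1)
    (hη : η = v1 / v2) (ht : tstar = (η - β / 2) / (1 - β))
    (hβ : β ≤ min (2 * η) (2 * (1 - η)))
    (hαstar : αstar ∈ Set.Icc (0 : ℝ) 1) :
    mergedSet v1 v2 β tstar αstar
      = {q : ℝ × ℝ | ∃ s ∈ Sprime v1 v2 tstar αstar,
          q = β • ((tstar * αstar * (v2 - v1),
                    tstar * v1 + (1 - tstar) * αstar * v2) : ℝ × ℝ) + (1 - β) • s} := by
  ext p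
  constructor
  · rintro ⟨α1, α2, γ1, γ2, h1, h2, h3, h4, hγ, hα, rfl⟩
    exact ⟨_, ⟨α1, α2, γ1, γ2, h1, h2, h3, h4, hγ, hα, rfl⟩, merged_eq_shift_add_smul hγ hα⟩
  · rintro ⟨_, ⟨α1, α2, γ1, γ2, h1, h2, h3, h4, hγ, hα, rfl⟩, rfl⟩
    exact ⟨α1, α2, γ1, γ2, h1, h2, h3, h4, hγ, hα, (merged_eq_shift_add_smul hγ hα).symm⟩
end

section
/- Assume β ≤ min{2η, 2(1−η)}, β < 2(1−η) (so t* < 1), and α* ≥ t*. Then S' equals the convex hull in ℝ² of the three points E := (0, α*·v2 + (1−α*)·v1), F := (0, α*·v2), and G := E + (ξ, −ξ), where ξ := (1−α*)·(t*/(1−t*))·(v2−v1). -/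
/-- The parametrization of `Sprime` by `x = γ1 * α1` and `g = γ1`, in which all constraints are
linear. -/
lemma mem_Sprime_iff {v1 v2 t a : ℝ} (ht0 : 0 ≤ t) (ht1 : t < 1) (hta : t ≤ a) (ha1 : a ≤ 1)
    (p : ℝ × ℝ) :
    p ∈ Sprime v1 v2 t a ↔ ∃ x g : ℝ, 0 ≤ g ∧ 0 ≤ x ∧ x ≤ t * g ∧ g ≤ 1 - a + x ∧
      p = (x * (v2 - v1), g * v1 + (a - x) * v2) := by
  unfold Sprime
  rw [min_eq_left hta, max_eq_right hta]
  constructor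
  · rintro ⟨α1, α2, γ1, γ2, ⟨h1, h2⟩, ⟨h3, h4⟩, ⟨h5, h6⟩, ⟨h7, h8⟩, h9, h10, rfl⟩
    refine ⟨γ1 * α1, γ1, h5, mul_nonneg h5 h1, ?_, ?_, ?_⟩
    · nlinarith
    · nlinarith
    · rw [show a - γ1 * α1 = γ2 * α2 by linarith]
  · rintro ⟨x, g, hg, hx, hxt, hgx, rfl⟩
    have hxa : x ≤ a * g := hxt.trans (mul_le_mul_of_nonneg_right hta hg)
    have hg1 : g ≤ 1 := by
      by_contra! h
      nlinarith [mul_nonneg (sub_nonneg.2 hta) (sub_nonneg.2 h.le),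
        mul_pos (sub_pos.2 ht1) (sub_pos.2 h)]
    have hα1 : ∃ α1 ∈ Set.Icc 0 t, g * α1 = x := by
      rcases hg.eq_or_lt with h | h
      · subst h
        exact ⟨0, ⟨le_rfl, ht0⟩, by linarith⟩
      · exact ⟨x / g, ⟨by positivity, (div_le_iff₀ h).2 hxt⟩, mul_div_cancel₀ x h.ne'⟩
    have hα2 : ∃ α2 ∈ Set.Icc a 1, (1 - g) * α2 = a - x := by
      rcases hg1.eq_or_lt with h | h
      · subst h
        exact ⟨1, ⟨ha1, le_rfl⟩, by linarith⟩
      · have h' : 0 < 1 - g := sub_pos.2 h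
        exact ⟨(a - x) / (1 - g), ⟨(le_div_iff₀ h').2 (by linarith),
          (div_le_iff₀ h').2 (by linarith)⟩, mul_div_cancel₀ _ h'.ne'⟩
    obtain ⟨α1, h1, e1⟩ := hα1
    obtain ⟨α2, h2, e2⟩ := hα2
    refine ⟨α1, α2, g, 1 - g, h1, h2, ⟨hg, hg1⟩, ⟨by linarith, by linarith⟩, by ring, ?_, ?_⟩
    · linarith
    · rw [e1, e2]

lemma convex_Sprime {v1 v2 t a : ℝ} (ht0 : 0 ≤ t) (ht1 : t < 1) (hta : t ≤ a) (ha1 : a ≤ 1) :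
    Convex ℝ (Sprime v1 v2 t a) := by
  intro p hp q hq r s hr hs hrs
  rw [mem_Sprime_iff ht0 ht1 hta ha1] at hp hq ⊢
  obtain ⟨x, g, h1, h2, h3, h4, rfl⟩ := hp
  obtain ⟨y, k, k1, k2, k3, k4, rfl⟩ := hq
  obtain rfl : s = 1 - r := by linarith
  refine ⟨r * x + (1 - r) * y, r * g + (1 - r) * k, by positivity, by positivity, ?_, ?_, ?_⟩
  · nlinarith [mul_le_mul_of_nonneg_left h3 hr, mul_le_mul_of_nonneg_left k3 hs]
  · nlinarith [mul_le_mul_of_nonneg_left h4 hr, mul_le_mul_of_nonneg_left k4 hs]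
  · ext <;> simp <;> ring

lemma combo_mem_convexHull_triple {E : Type*} [AddCommGroup E] [Module ℝ E] (x y z : E)
    {p q r : ℝ} (hp : 0 ≤ p) (hq : 0 ≤ q) (hr : 0 ≤ r) (h : p + q + r = 1) :
    p • x + q • y + r • z ∈ convexHull ℝ ({x, y, z} : Set E) := by
  have hmem : ∀ i ∈ Finset.univ, (![x, y, z] : Fin 3 → E) i ∈ convexHull ℝ ({x, y, z} : Set E) := by
    intro i _
    apply subset_convexHull
    fin_cases i <;> simp
  have := (convex_convexHull ℝ ({x, y, z} : Set E)).sum_mem (t := Finset.univ)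
    (w := ![p, q, r]) (z := ![x, y, z])
    (by intro i _; fin_cases i <;> simpa) (by simpa [Fin.sum_univ_three] using h) hmem
  simpa [Fin.sum_univ_three] using this

/-- for `β ≤ min{2η, 2(1−η)}`, `β < 2(1−η)` (so `t* < 1`) and
`α* ≥ t*`, the set `S'` is the triangle with vertices
`E = (0, α*·v2 + (1−α*)·v1)`, `F = (0, α*·v2)` and `G = E + (ξ, −ξ)` where
`ξ = (1−α*)·(t*/(1−t*))·(v2−v1)`. -/
theorem stmt_4 (v1 v2 β η tstar αstar : ℝ)
    (hv1 : 0 < v1) (hv12 : v1 < v2)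
    (hβ0 : 0 ≤ β) (hβ1 : β < 1)
    (hη : η = v1 / v2) (ht : tstar = (η - β / 2) / (1 - β))
    (hβ : β ≤ min (2 * η) (2 * (1 - η)))
    (hβ' : β < 2 * (1 - η))
    (hαstar : αstar ∈ Set.Icc (0 : ℝ) 1)
    (hat : tstar ≤ αstar) :
    Sprime v1 v2 tstar αstar
      = convexHull ℝ
          ({((0 : ℝ), αstar * v2 + (1 - αstar) * v1),
            ((0 : ℝ), αstar * v2),
            ((0 : ℝ), αstar * v2 + (1 - αstar) * v1) +
              ((1 - αstar) * (tstar / (1 - tstar)) * (v2 - v1),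
               -((1 - αstar) * (tstar / (1 - tstar)) * (v2 - v1)))} : Set (ℝ × ℝ)) := by
  have hβη := le_min_iff.1 hβ
  have hb : 0 < 1 - β := sub_pos.2 hβ1
  have ht0 : 0 ≤ tstar := by
    rw [ht]
    exact div_nonneg (by linarith [hβη.1]) hb.le
  have ht1 : tstar < 1 := by
    rw [ht, div_lt_one hb]
    linarith
  have ha1 := hαstar.2
  have hu : 0 < 1 - tstar := sub_pos.2 ht1
  have hc : 0 ≤ 1 - αstar := sub_nonneg.2 ha1
  apply Set.Subset.antisymm
  · intro p hp
    obtain ⟨x, g, hg, hx, hxt, hgx, rfl⟩ := (mem_Sprime_iff ht0 ht1 hat ha1 p).1 hp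
    obtain ⟨p, q, r, hp, hq, hr, hpqr, hxr, hgr⟩ : ∃ p q r : ℝ, 0 ≤ p ∧ 0 ≤ q ∧ 0 ≤ r ∧
        p + q + r = 1 ∧ x = r * ((1 - αstar) * (tstar / (1 - tstar))) ∧
        g = p * (1 - αstar) + r * (1 - αstar) + x := by
      rcases hc.eq_or_lt with hc0 | hc0
      · have hg0 : g = 0 := by nlinarith
        subst hg0
        exact ⟨0, 1, 0, le_rfl, zero_le_one, le_rfl, by ring, by linarith, by linarith⟩
      rcases ht0.eq_or_lt with h | h
      · subst h
        obtain rfl : x = 0 := by linarith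
        refine ⟨g / (1 - αstar), 1 - g / (1 - αstar), 0, by positivity, ?_, le_rfl, by ring,
          by simp, by field_simp; ring⟩
        rw [sub_nonneg, div_le_one hc0]
        linarith
      · refine ⟨(g - x / tstar) / (1 - αstar), 1 - (g - x) / (1 - αstar),
          x * (1 - tstar) / (tstar * (1 - αstar)), ?_, ?_, by positivity, ?_, ?_, ?_⟩
        · refine div_nonneg (sub_nonneg.2 ?_) hc
          rw [div_le_iff₀ h]
          linarith
        · rw [sub_nonneg, div_le_one hc0]
          linarith
        all_goals
          field_simp
          try ring
    convert combo_mem_convexHull_triple _ _ _ hp hq hr hpqr using 1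
    obtain rfl : q = 1 - p - r := by linarith
    ext
    · simp only [Prod.fst_add, Prod.smul_fst, smul_eq_mul]
      rw [hxr]
      ring
    · simp only [Prod.snd_add, Prod.smul_snd, smul_eq_mul]
      rw [hgr, hxr]
      ring
  · refine convexHull_min ?_ (convex_Sprime ht0 ht1 hat ha1)
    rintro p (rfl | rfl | rfl) <;> rw [mem_Sprime_iff ht0 ht1 hat ha1]
    · exact ⟨0, 1 - αstar, hc, le_rfl, by positivity, by linarith, by ext <;> simp; ring⟩
    · exact ⟨0, 0, le_rfl, le_rfl, by simp, by linarith, by ext <;> simp⟩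
    · refine ⟨(1 - αstar) * (tstar / (1 - tstar)), (1 - αstar) / (1 - tstar), by positivity,
        by positivity, le_of_eq (by ring), le_of_eq (by field_simp; ring), ?_⟩
      ext
      · simp
      · simp only [Prod.snd_add]
        field_simp
        ring
end

section
/- Assume β ≤ min{2η, 2(1−η)}, β < 2η (so t* > 0), and α* ≤ t*. Then S' equals the convex hull in ℝ² of the three points E := (0, α*·v2 + (1−α*)·v1), F := (α*·(v2−v1), v1), and G := (0, v1 + α*·v2·(1 − η/t*)). -/
/-- Membership in a triangle in terms of barycentric coordinates. -/
theorem mem_convexHull_triple {E : Type*} [AddCommGroup E] [Module ℝ E] (A B C p : E) :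
    p ∈ convexHull ℝ ({A, B, C} : Set E) ↔
      ∃ a b c : ℝ, 0 ≤ a ∧ 0 ≤ b ∧ 0 ≤ c ∧ a + b + c = 1 ∧ a • A + b • B + c • C = p := by
  constructor
  · rw [convexHull_insert (by simp), convexHull_pair, mem_convexJoin]
    rintro ⟨x, rfl, y, ⟨r, s, hr, hs, hrs, rfl⟩, m, n, hm, hn, hmn, rfl⟩
    refine ⟨m, n * r, n * s, hm, mul_nonneg hn hr, mul_nonneg hn hs, ?_, ?_⟩
    · rw [add_assoc, ← mul_add, hrs, mul_one, hmn]
    · rw [smul_add, smul_smul, smul_smul, add_assoc]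
  · rintro ⟨a, b, c, ha, hb, hc, h, rfl⟩
    have key := (convex_convexHull ℝ ({A, B, C} : Set E)).sum_mem
      (t := Finset.univ) (w := ![a, b, c]) (z := ![A, B, C])
      (by intro i _; fin_cases i <;> simpa) (by simpa [Fin.sum_univ_three] using h)
      (by intro i _; apply subset_convexHull; fin_cases i <;> simp)
    simpa [Fin.sum_univ_three] using key

/-- for `β ≤ min{2η, 2(1−η)}`, `β < 2η` (so `t* > 0`) and `α* ≤ t*`,
the set `S'` is the triangle with vertices `E = (0, α*·v2 + (1−α*)·v1)`,
`F = (α*·(v2−v1), v1)` and `G = (0, v1 + α*·v2·(1 − η/t*))`. -/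
theorem stmt_5 (v1 v2 β η tstar αstar : ℝ)
    (hv1 : 0 < v1) (hv12 : v1 < v2)
    (hβ0 : 0 ≤ β) (hβ1 : β < 1)
    (hη : η = v1 / v2) (ht : tstar = (η - β / 2) / (1 - β))
    (hβ : β ≤ min (2 * η) (2 * (1 - η)))
    (hβ' : β < 2 * η)
    (hαstar : αstar ∈ Set.Icc (0 : ℝ) 1)
    (hat : αstar ≤ tstar) :
    Sprime v1 v2 tstar αstar
      = convexHull ℝ
          ({((0 : ℝ), αstar * v2 + (1 - αstar) * v1),
            (αstar * (v2 - v1), v1),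
            ((0 : ℝ), v1 + αstar * v2 * (1 - η / tstar))} : Set (ℝ × ℝ)) := by
  have hv2 : 0 < v2 := hv1.trans hv12
  have hβη : β ≤ 2 * (1 - η) := hβ.trans (min_le_right _ _)
  have ht0 : 0 < tstar := by
    rw [ht]
    exact div_pos (by linarith) (by linarith)
  have ht1 : tstar ≤ 1 := by
    rw [ht, div_le_one (by linarith)]
    linarith
  have hG : v1 + αstar * v2 * (1 - η / tstar) = v1 + αstar * v2 - αstar / tstar * v1 := by
    rw [hη]
    field_simp
    ring
  clear ht hβ hβ' hβη
  obtain ⟨ha0, -⟩ := hαstar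
  rw [hG]
  ext p
  rw [mem_convexHull_triple]
  simp only [Sprime, Set.mem_ofPred_eq, min_eq_right hat, max_eq_left hat, Set.mem_Icc]
  constructor
  · rintro ⟨α1, α2, γ1, γ2, ⟨h10, h1a⟩, ⟨h2t, h21⟩, ⟨hγ10, hγ11⟩, ⟨hγ20, hγ21⟩, hγ, hmean, rfl⟩
    have hw0 : 0 ≤ γ2 * α2 := mul_nonneg hγ20 (ht0.le.trans h2t)
    have hu0 : 0 ≤ γ1 * α1 := mul_nonneg hγ10 h10
    obtain ha | ha := ha0.eq_or_lt
    · have hw : γ2 * α2 = 0 := by linarith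
      have hu : γ1 * α1 = 0 := by linarith
      have hγ2 : γ2 = 0 := (mul_eq_zero.mp hw).resolve_right (by linarith)
      have hγ1 : γ1 = 1 := by linarith
      refine ⟨0, 1, 0, le_rfl, zero_le_one, le_rfl, by norm_num, ?_⟩
      rw [hu, hw, hγ1, ← ha]
      simp
    · obtain ht | ht := ht1.eq_or_lt
      · have h2 : α2 = 1 := by linarith
        subst h2
        refine ⟨γ2 / αstar, γ1 * α1 / αstar, 0, by positivity, by positivity, le_rfl, ?_, ?_⟩
        · field_simp
          linarith
        · ext
          · simp
            field_simp
          · simp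
            field_simp
            linear_combination v1 * hmean - αstar * v1 * hγ
      · have hs : 0 < 1 - tstar := by linarith
        refine ⟨γ2 * (α2 - tstar) / (αstar * (1 - tstar)), γ1 * α1 / αstar,
          tstar * (γ2 * (1 - α2)) / (αstar * (1 - tstar)), ?_, by positivity, ?_, ?_, ?_⟩
        · exact div_nonneg (mul_nonneg hγ20 (by linarith)) (by positivity)
        · exact div_nonneg (mul_nonneg ht0.le (mul_nonneg hγ20 (by linarith))) (by positivity)
        · field_simp
          linear_combination (1 - tstar) * hmean
        · obtain rfl : γ1 = 1 - γ2 := by linarith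
          obtain rfl : αstar = (1 - γ2) * α1 + γ2 * α2 := hmean.symm
          ext
          · simp
            field_simp
          · simp
            field_simp
            ring
  · rintro ⟨e, f, g, he, hf, hg, hsum, rfl⟩
    have hgt : g ≤ g / tstar := le_div_self hg ht0 ht1
    have hat1 : αstar / tstar ≤ 1 := (div_le_one ht0).mpr hat
    set γ := e * αstar + g * (αstar / tstar) with hγ
    have hγ0 : 0 ≤ γ := by positivity
    have htγ : tstar * γ = αstar * (e * tstar + g) := by
      rw [hγ]
      field_simp
    have hγw : αstar * (e + g) ≤ γ := by
      have := mul_le_mul_of_nonneg_left hgt ha0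
      have h2 : αstar * (g / tstar) = g * (αstar / tstar) := by ring
      rw [hγ]
      linarith
    have htw : tstar * γ ≤ αstar * (e + g) := by
      rw [htγ]
      exact mul_le_mul_of_nonneg_left (by nlinarith) ha0
    have hγ1 : γ ≤ e + g := by
      rw [hγ]
      nlinarith
    obtain ⟨α1, h10, h1a, h1⟩ : ∃ x, 0 ≤ x ∧ x ≤ αstar ∧ (1 - γ) * x = f * αstar := by
      obtain h | h := (show 0 ≤ 1 - γ by linarith).eq_or_lt
      · refine ⟨0, le_rfl, ha0, ?_⟩
        have : f = 0 := by linarith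
        simp [this]
      · refine ⟨f * αstar / (1 - γ), by positivity, ?_, by field_simp⟩
        rw [div_le_iff₀ h]
        nlinarith
    obtain ⟨α2, h2t, h21, h2⟩ : ∃ x, tstar ≤ x ∧ x ≤ 1 ∧ γ * x = αstar * (e + g) := by
      obtain h | h := hγ0.eq_or_lt
      · refine ⟨1, ht1, le_rfl, ?_⟩
        have : 0 ≤ αstar * (e + g) := by positivity
        linarith
      · refine ⟨αstar * (e + g) / γ, ?_, ?_, by field_simp⟩
        · rwa [le_div_iff₀ h]
        · rwa [div_le_one h]
    refine ⟨α1, α2, 1 - γ, γ, ⟨h10, h1a⟩, ⟨h2t, h21⟩, ⟨by linarith, by linarith⟩,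
      ⟨hγ0, by linarith⟩, by ring, ?_, ?_⟩
    · rw [h1, h2]
      linear_combination αstar * hsum
    · rw [h1, h2]
      ext
      · simp
        ring
      · simp
        rw [hγ]
        linear_combination v1 * hsum
end

section
/- Assume β < 2η and β < 2(1−η) (so 0 < t* < 1). Then the merged utility set M equals the convex hull in ℝ² of the three points A := β·c + (1−β)·(0, α*·v2 + v1·max(t* − α*, 0)/t*), B := β·c + (1−β)·(0, α*·v2 + (1−α*)·v1), and C := β·c + (1−β)·(α*·(v2−v1) − (v2−v1)·max(α* − t*, 0)/(1−t*), v1 + (v2−v1)·max(α* − t*, 0)/(1−t*)). -/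
/-- The constant shift vector `c`. -/
def shiftC (v1 v2 tstar αstar : ℝ) : ℝ × ℝ :=
  (tstar * αstar * (v2 - v1), tstar * v1 + (1 - tstar) * αstar * v2)

/-- Membership in the convex hull of three points, in barycentric coordinates. -/
lemma mem_convexHull_triple_iff {E : Type*} [AddCommGroup E] [Module ℝ E] {A B C p : E} :
    p ∈ convexHull ℝ ({A, B, C} : Set E) ↔
      ∃ a b c : ℝ, 0 ≤ a ∧ 0 ≤ b ∧ 0 ≤ c ∧ a + b + c = 1 ∧ a • A + b • B + c • C = p := by
  constructor
  · intro hp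
    rw [convexHull_insert (Set.insert_nonempty _ _), convexHull_pair] at hp
    simp only [convexJoin_singleton_left, Set.mem_iUnion] at hp
    obtain ⟨q, ⟨b, c, hb, hc, hbc, rfl⟩, ⟨a, d, ha, hd, had, rfl⟩⟩ := hp
    refine ⟨a, d * b, d * c, ha, mul_nonneg hd hb, mul_nonneg hd hc, ?_, ?_⟩
    · linear_combination had + d * hbc
    · module
  · rintro ⟨a, b, c, ha, hb, hc, h, rfl⟩
    have hconv := convex_convexHull ℝ ({A, B, C} : Set E)
    have hmem := subset_convexHull ℝ ({A, B, C} : Set E)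
    have hsum := hconv.sum_mem (t := Finset.univ) (w := ![a, b, c]) (z := ![A, B, C])
      (by intro i _; fin_cases i <;> simpa) (by simpa [Fin.sum_univ_three] using h)
      (by intro i _; fin_cases i <;> exact hmem (by simp))
    simpa [Fin.sum_univ_three] using hsum

/-- The pairs `(g, x) = (γ₁, γ₁ α₁)` that occur in `mergedSet`. -/
def IsFeasiblePair (t a g x : ℝ) : Prop :=
  0 ≤ g ∧ g ≤ 1 ∧ 0 ≤ x ∧ x ≤ g * min t a ∧ (1 - g) * max t a ≤ a - x ∧ a - x ≤ 1 - g

lemma exists_mul_eq_of_mem_Icc {g x l u : ℝ} (hlu : l ≤ u) (hg : 0 ≤ g)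
    (hl : g * l ≤ x) (hu : x ≤ g * u) : ∃ α ∈ Set.Icc l u, g * α = x := by
  rcases hg.eq_or_lt with rfl | hg
  · exact ⟨l, ⟨le_rfl, hlu⟩, by linarith⟩
  · refine ⟨x / g, ⟨?_, ?_⟩, by field_simp⟩
    · rw [le_div_iff₀ hg]; linarith
    · rw [div_le_iff₀ hg]; linarith

lemma mem_mergedSet_iff {v1 v2 β t a : ℝ} (ht0 : 0 ≤ t) (ht1 : t ≤ 1) (ha0 : 0 ≤ a) (ha1 : a ≤ 1)
    {p : ℝ × ℝ} :
    p ∈ mergedSet v1 v2 β t a ↔ ∃ g x, IsFeasiblePair t a g x ∧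
      p = β • shiftC v1 v2 t a + (1 - β) • (((v2 - v1) * x, g * v1 + (a - x) * v2) : ℝ × ℝ) := by
  constructor
  · rintro ⟨α1, α2, γ1, γ2, ⟨h1, h1'⟩, ⟨h2, h2'⟩, ⟨hγ, hγ'⟩, ⟨hδ, hδ'⟩, hsum, hmean, rfl⟩
    obtain rfl : γ2 = 1 - γ1 := by linarith
    have hy : a - γ1 * α1 = (1 - γ1) * α2 := by linarith
    refine ⟨γ1, γ1 * α1, ⟨hγ, hγ', mul_nonneg hγ h1, mul_le_mul_of_nonneg_left h1' hγ, ?_, ?_⟩, ?_⟩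
    · rw [hy]; exact mul_le_mul_of_nonneg_left h2 hδ
    · rw [hy]; exact mul_le_of_le_one_right hδ h2'
    · subst hmean
      ext <;> simp [shiftC, f1, f2, g1, g2] <;> ring
  · rintro ⟨g, x, ⟨hg, hg', hx, hx', hy, hy'⟩, rfl⟩
    obtain ⟨α1, hα1, e1⟩ := exists_mul_eq_of_mem_Icc (le_min ht0 ha0) hg (by simpa using hx) hx'
    obtain ⟨α2, hα2, e2⟩ := exists_mul_eq_of_mem_Icc (max_le ht1 ha1) (sub_nonneg.2 hg') hy
      (by simpa using hy')
    have hmean : g * α1 + (1 - g) * α2 = a := by linarith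
    refine ⟨α1, α2, g, 1 - g, hα1, hα2, ⟨hg, hg'⟩, ⟨by linarith, by linarith⟩, by ring, hmean, ?_⟩
    subst e1
    subst hmean
    ext <;> simp [shiftC, f1, f2, g1, g2] <;> ring

/-- The feasible pairs form the triangle with vertices `(max (t - a) 0 / t, 0)`, `(1 - a, 0)` and
`(1 - h, a - h)`, where `h = max (a - t) 0 / (1 - t)`. -/
lemma isFeasiblePair_iff {t a g x : ℝ} (ht0 : 0 < t) (ht1 : t < 1) (ha0 : 0 ≤ a) (ha1 : a ≤ 1) :
    IsFeasiblePair t a g x ↔ ∃ r s u : ℝ, 0 ≤ r ∧ 0 ≤ s ∧ 0 ≤ u ∧ r + s + u = 1 ∧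
      g = r * (max (t - a) 0 / t) + s * (1 - a) + u * (1 - max (a - t) 0 / (1 - t)) ∧
      x = u * (a - max (a - t) 0 / (1 - t)) := by
  have ht1' : 0 < 1 - t := sub_pos.2 ht1
  unfold IsFeasiblePair
  rcases le_or_gt a t with hat | hat
  · rw [min_eq_right hat, max_eq_left hat, max_eq_left (sub_nonneg.2 hat),
      max_eq_right (sub_nonpos.2 hat)]
    constructor
    · rintro ⟨hg, hg', hx, hx', hy, hy'⟩
      rcases ha0.eq_or_lt with rfl | ha
      · refine ⟨0, 0, 1, by norm_num, by norm_num, by norm_num, by norm_num, ?_, ?_⟩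
        · simp only [zero_div]; nlinarith
        · simp only [zero_div]; linarith
      · refine ⟨(x - a + 1 - g) * t / (a * (1 - t)), (a - x - (1 - g) * t) / (a * (1 - t)), x / a,
          div_nonneg (mul_nonneg (by linarith) ht0.le) (by positivity),
          div_nonneg (by linarith) (by positivity), by positivity, ?_, ?_, ?_⟩ <;>
        field_simp <;> ring
    · rintro ⟨r, s, u, hr, hs, hu, hsum, rfl, rfl⟩
      obtain ⟨k, hk⟩ : ∃ k, k = a / t := ⟨_, rfl⟩
      have hkt : k * t = a := by rw [hk]; field_simp
      have hk0 : 0 ≤ k := by rw [hk]; positivity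
      have hk1 : k ≤ 1 := by rw [hk]; exact (div_le_one ht0).2 hat
      have hA : (t - a) / t = 1 - k := by rw [hk]; field_simp
      obtain rfl : s = 1 - r - u := by linarith
      rw [hA, ← hkt]
      have hk1' : 0 ≤ 1 - k := sub_nonneg.2 hk1
      simp only [zero_div]
      refine ⟨?_, ?_, ?_, ?_, ?_, ?_⟩
      · have h : 0 ≤ r * (1 - k) + (1 - r - u) * ((1 - k) + k * (1 - t)) + u := by positivity
        linarith
      · have h : 0 ≤ r * k + (1 - r - u) * (k * t) := by positivity
        linarith
      · have h : 0 ≤ u * (k * t) := by positivity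
        linarith
      · have h : 0 ≤ k * t * (r * (1 - k) + (1 - r - u) * ((1 - k) + k * (1 - t))) := by positivity
        linarith
      · have h : 0 ≤ (1 - r - u) * (k * t * (1 - t)) := by positivity
        linarith
      · have h : 0 ≤ r * k * (1 - t) := by positivity
        linarith
  · rw [min_eq_left hat.le, max_eq_right hat.le, max_eq_right (sub_nonpos.2 hat.le),
      max_eq_left (sub_nonneg.2 hat.le)]
    constructor
    · rintro ⟨hg, hg', hx, hx', hy, hy'⟩
      rcases ha1.eq_or_lt with rfl | ha
      · have : g = 0 := by nlinarith
        subst this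
        refine ⟨1, 0, 0, by norm_num, by norm_num, by norm_num, by norm_num, ?_, ?_⟩
        · simp
        · linarith
      · have ha' : 0 < 1 - a := sub_pos.2 ha
        refine ⟨(x - a + 1 - g) / (1 - a), (g * t - x) / (t * (1 - a)), x * (1 - t) / (t * (1 - a)),
          div_nonneg (by linarith) (by positivity),
          div_nonneg (by linarith) (by positivity), by positivity, ?_, ?_, ?_⟩ <;>
        field_simp <;> ring
    · rintro ⟨r, s, u, hr, hs, hu, hsum, rfl, rfl⟩
      obtain ⟨k, hk⟩ : ∃ k, k = (1 - a) / (1 - t) := ⟨_, rfl⟩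
      have hkt : a = 1 - k * (1 - t) := by rw [hk]; field_simp; ring
      have hk0 : 0 ≤ k := by rw [hk]; exact div_nonneg (by linarith) ht1'.le
      have hk1 : k ≤ 1 := by rw [hk]; exact (div_le_one ht1').2 (by linarith)
      have hA : (a - t) / (1 - t) = 1 - k := by rw [hk]; field_simp; ring
      obtain rfl : r = 1 - s - u := by linarith
      rw [hA, hkt]
      have hk1' : 0 ≤ 1 - k := sub_nonneg.2 hk1
      simp only [zero_div]
      refine ⟨?_, ?_, ?_, ?_, ?_, ?_⟩
      · have h : 0 ≤ s * (k * (1 - t)) + u * k := by positivity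
        linarith
      · have h : 0 ≤ (1 - s - u) + s * ((1 - k) + k * t) + u * (1 - k) := by positivity
        linarith
      · have h : 0 ≤ u * k * t := by positivity
        linarith
      · have h : 0 ≤ s * k * (1 - t) * t := by positivity
        linarith
      · have h : 0 ≤ s * k * (1 - t) * ((1 - k) + k * t) + u * k * ((1 - t) * (1 - k)) := by positivity
        linarith
      · have h : 0 ≤ k * (1 - t) * (1 - s - u) := by positivity
        linarith

/-- Theorem `S`, case `K = 2`: under `β < 2η` and `β < 2(1−η)` (so
`0 < t* < 1`), the merged utility set `M` is the triangle with vertices `A`, `B`, `C`. -/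
theorem stmt_6 (v1 v2 β η tstar αstar : ℝ)
    (hv1 : 0 < v1) (hv12 : v1 < v2)
    (hβ0 : 0 ≤ β) (hβ1 : β < 1)
    (hη : η = v1 / v2) (ht : tstar = (η - β / 2) / (1 - β))
    (hβlow : β < 2 * η) (hβhigh : β < 2 * (1 - η))
    (hαstar : αstar ∈ Set.Icc (0 : ℝ) 1) :
    mergedSet v1 v2 β tstar αstar
      = convexHull ℝ
          ({β • shiftC v1 v2 tstar αstar +
              (1 - β) • (((0 : ℝ), αstar * v2 + v1 * max (tstar - αstar) 0 / tstar) : ℝ × ℝ),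
            β • shiftC v1 v2 tstar αstar +
              (1 - β) • (((0 : ℝ), αstar * v2 + (1 - αstar) * v1) : ℝ × ℝ),
            β • shiftC v1 v2 tstar αstar +
              (1 - β) • ((αstar * (v2 - v1) - (v2 - v1) * max (αstar - tstar) 0 / (1 - tstar),
                v1 + (v2 - v1) * max (αstar - tstar) 0 / (1 - tstar)) : ℝ × ℝ)} : Set (ℝ × ℝ)) := by
  have hv2 : 0 < v2 := hv1.trans hv12
  have hβ : 0 < 1 - β := sub_pos.2 hβ1
  have ht0 : 0 < tstar := by rw [ht]; exact div_pos (by linarith) hβ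
  have ht1 : tstar < 1 := by rw [ht, div_lt_one hβ]; linarith
  obtain ⟨ha0, ha1⟩ := hαstar
  ext p
  rw [mem_mergedSet_iff ht0.le ht1.le ha0 ha1, mem_convexHull_triple_iff]
  simp only [isFeasiblePair_iff ht0 ht1 ha0 ha1, mul_div_assoc]
  constructor
  · rintro ⟨g, x, ⟨r, s, u, hr, hs, hu, hsum, rfl, rfl⟩, rfl⟩
    refine ⟨r, s, u, hr, hs, hu, hsum, ?_⟩
    obtain rfl : r = 1 - s - u := by linarith
    ext <;> simp <;> ring
  · rintro ⟨r, s, u, hr, hs, hu, hsum, rfl⟩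
    refine ⟨_, _, ⟨r, s, u, hr, hs, hu, hsum, rfl, rfl⟩, ?_⟩
    obtain rfl : r = 1 - s - u := by linarith
    ext <;> simp <;> ring
end

section
/- For each i ∈ {1,...,K}, the set X_i^β is nonempty if and only if the point mass e_i at value v_i (the market with i-th coordinate 1 and all other coordinates 0) belongs to X_i^β, equivalently if and only if for every j ∈ {1,...,K}: v_i·((1−β) + β·(K+1−i)/K) ≥ v_j·((1−β)·[j ≤ i] + β·(K+1−j)/K), where [j ≤ i] is 1 if j ≤ i and 0 otherwise. (This is the condition β ≤ β̄_i of the paper.) -/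
/-- The set of markets: the standard simplex on value indices `1, …, K`. -/
def simplex (K : ℕ) : Set (ℕ → ℝ) :=
  {x | (∀ k ∈ Finset.Icc 1 K, 0 ≤ x k) ∧ ∑ k ∈ Finset.Icc 1 K, x k = 1}

/-- `X_i^β`: the set of markets for which `v_i` is an optimal price under the
privacy mechanism with parameter `β`. -/
def Xopt (K : ℕ) (v : ℕ → ℝ) (β : ℝ) (i : ℕ) : Set (ℕ → ℝ) :=
  {x | x ∈ simplex K ∧ ∀ j ∈ Finset.Icc 1 K,
    v i * ((1 - β) * ∑ k ∈ Finset.Icc i K, x k + β * ((K : ℝ) + 1 - i) / K) ≥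
      v j * ((1 - β) * ∑ k ∈ Finset.Icc j K, x k + β * ((K : ℝ) + 1 - j) / K)}

/-- Tail sums of a point mass at `i`. -/
lemma sum_Icc_pointMass (K i j : ℕ) (hiK : i ≤ K) :
    ∑ k ∈ Finset.Icc j K, (if k = i then (1 : ℝ) else 0) = if j ≤ i then 1 else 0 := by
  simp [Finset.sum_ite_eq', hiK]

lemma pointMass_mem_simplex {K i : ℕ} (hi : i ∈ Finset.Icc 1 K) :
    (fun k => if k = i then (1 : ℝ) else 0) ∈ simplex K := by
  rw [Finset.mem_Icc] at hi
  refine ⟨fun k _ => by dsimp only; split_ifs <;> norm_num, ?_⟩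
  rw [sum_Icc_pointMass K i 1 hi.2, if_pos hi.1]

lemma pointMass_mem_Xopt_iff {K : ℕ} {v : ℕ → ℝ} {β : ℝ} {i : ℕ} (hi : i ∈ Finset.Icc 1 K) :
    (fun k => if k = i then (1 : ℝ) else 0) ∈ Xopt K v β i ↔ ∀ j ∈ Finset.Icc 1 K,
      v i * ((1 - β) + β * ((K : ℝ) + 1 - i) / K) ≥
        v j * ((1 - β) * (if j ≤ i then (1 : ℝ) else 0) + β * ((K : ℝ) + 1 - j) / K) := by
  have hiK := (Finset.mem_Icc.mp hi).2
  simp only [Xopt, Set.mem_ofPred_eq, pointMass_mem_simplex hi, true_and,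
    sum_Icc_pointMass K i _ hiK, le_refl, if_true, mul_one]

lemma sum_Icc_anti_of_mem_simplex {K : ℕ} {x : ℕ → ℝ} (hx : x ∈ simplex K) {j l : ℕ}
    (hj : 1 ≤ j) (hjl : j ≤ l) :
    ∑ k ∈ Finset.Icc l K, x k ≤ ∑ k ∈ Finset.Icc j K, x k :=
  Finset.sum_le_sum_of_subset_of_nonneg (Finset.Icc_subset_Icc_left hjl)
    fun k hk _ => hx.1 k (Finset.Icc_subset_Icc_left hj hk)

lemma sum_Icc_nonneg_of_mem_simplex {K : ℕ} {x : ℕ → ℝ} (hx : x ∈ simplex K) {j : ℕ}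
    (hj : 1 ≤ j) : 0 ≤ ∑ k ∈ Finset.Icc j K, x k :=
  Finset.sum_nonneg fun k hk => hx.1 k (Finset.Icc_subset_Icc_left hj hk)

lemma sum_Icc_le_one_of_mem_simplex {K : ℕ} {x : ℕ → ℝ} (hx : x ∈ simplex K) {j : ℕ}
    (hj : 1 ≤ j) : ∑ k ∈ Finset.Icc j K, x k ≤ 1 :=
  hx.2 ▸ sum_Icc_anti_of_mem_simplex hx le_rfl hj

/-- If `v_i` is optimal in some market, it stays optimal when all mass is moved to `v_i`. -/
lemma pointMass_mem_Xopt_of_mem {K : ℕ} {v : ℕ → ℝ}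
    (hv : ∀ k ∈ Finset.Icc 1 K, 0 < v k)
    (hmono : ∀ j ∈ Finset.Icc 1 K, ∀ k ∈ Finset.Icc 1 K, j < k → v j < v k)
    {β : ℝ} (hβ1 : β < 1) {i : ℕ} (hi : i ∈ Finset.Icc 1 K)
    {x : ℕ → ℝ} (hx : x ∈ Xopt K v β i) :
    (fun k => if k = i then (1 : ℝ) else 0) ∈ Xopt K v β i := by
  rw [pointMass_mem_Xopt_iff hi]
  intro j hj
  obtain ⟨hxs, hopt⟩ := hx
  have hij := hopt j hj
  have hi1 := (Finset.mem_Icc.mp hi).1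
  have hj1 := (Finset.mem_Icc.mp hj).1
  have hGi := sum_Icc_le_one_of_mem_simplex hxs hi1
  have hβ : 0 ≤ 1 - β := by linarith
  have hvi := (hv i hi).le
  have hvj := (hv j hj).le
  split_ifs with h
  · have hanti := sum_Icc_anti_of_mem_simplex hxs hj1 h
    have hvji : v j ≤ v i := by
      rcases h.eq_or_lt with rfl | h
      · exact le_rfl
      · exact (hmono j hj i hi h).le
    have key : v j * ((1 - β) * (1 - ∑ k ∈ Finset.Icc j K, x k)) ≤
        v i * ((1 - β) * (1 - ∑ k ∈ Finset.Icc i K, x k)) :=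
      mul_le_mul hvji (mul_le_mul_of_nonneg_left (by linarith) hβ)
        (mul_nonneg hβ (sub_nonneg.mpr (sum_Icc_le_one_of_mem_simplex hxs hj1))) hvi
    linarith
  · have hloss := mul_nonneg hvi (mul_nonneg hβ (sub_nonneg.mpr hGi))
    have hgain := mul_nonneg hvj (mul_nonneg hβ (sum_Icc_nonneg_of_mem_simplex hxs hj1))
    linarith

/-- Lemma on `β̄_i`: for each `i ∈ {1,…,K}`, the set `X_i^β` is
nonempty iff the point mass `e_i` at value `v_i` belongs to `X_i^β`, equivalently
iff for every `j ∈ {1,…,K}`: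
`v_i·((1−β) + β·(K+1−i)/K) ≥ v_j·((1−β)·[j ≤ i] + β·(K+1−j)/K)`. -/
theorem stmt_10 (K : ℕ) (hK : 1 ≤ K) (v : ℕ → ℝ)
    (hv : ∀ k ∈ Finset.Icc 1 K, 0 < v k)
    (hmono : ∀ j ∈ Finset.Icc 1 K, ∀ k ∈ Finset.Icc 1 K, j < k → v j < v k)
    (β : ℝ) (hβ0 : 0 ≤ β) (hβ1 : β < 1)
    (i : ℕ) (hi : i ∈ Finset.Icc 1 K) :
    ((Xopt K v β i).Nonempty ↔ (fun k => if k = i then (1 : ℝ) else 0) ∈ Xopt K v β i) ∧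
    ((Xopt K v β i).Nonempty ↔ ∀ j ∈ Finset.Icc 1 K,
        v i * ((1 - β) + β * ((K : ℝ) + 1 - i) / K) ≥
          v j * ((1 - β) * (if j ≤ i then (1 : ℝ) else 0) + β * ((K : ℝ) + 1 - j) / K)) := by
  have h : (Xopt K v β i).Nonempty ↔ (fun k => if k = i then (1 : ℝ) else 0) ∈ Xopt K v β i :=
    ⟨fun ⟨_, hx⟩ => pointMass_mem_Xopt_of_mem hv hmono hβ1 hi hx, fun hx => ⟨_, hx⟩⟩
  exact ⟨h, h.trans (pointMass_mem_Xopt_iff hi)⟩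
end
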